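/- Let α ∈ (0,1) be irrational, T the rotation of angle α viewed as a 2-interval exchange transformation on [0,1) with discontinuity 1 − α, N ≥ 2 an integer, and T_f the Veech 1969 type extension of T with single marked point ζ₁ and integers a₁, a₂. If ζ₁ = 2 − mα for an integer m ≥ 2 with 0 < 2 − mα < 1 and α < 1/(m−1), then T_f is minimal if and only if gcd(N, a₂ + (m−2)·a₁, m·a₁) = 1. -/

import Mathlib

open Set

noncomputable section

/-- The rotation of angle `α` on `[0,1)`: `x ↦ x + α mod 1`. -/
def rot (α : ℝ) (x : ℝ) : ℝ := Int.fract (x + α)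

/-- The skew product `T_f(x,s) = (Tx, s + f(x))` on `[0,1) × ℤ/Nℤ`. -/
def skew {N : ℕ} (T : ℝ → ℝ) (f : ℝ → ZMod N) : ℝ × ZMod N → ℝ × ZMod N :=
  fun p => (T p.1, p.2 + f p.1)

/-- Minimality of the skew product on `[0,1) × ℤ/Nℤ`, where `[0,1)` carries the topology of
the circle `ℝ/ℤ` (distances being measured in `AddCircle 1`) and `ℤ/Nℤ` is discrete:
every forward orbit is dense. -/
def MinimalExt {N : ℕ} (T : ℝ → ℝ) (f : ℝ → ZMod N) : Prop :=
  ∀ x ∈ Ico (0:ℝ) 1, ∀ s : ZMod N, ∀ y ∈ Ico (0:ℝ) 1, ∀ u : ZMod N, ∀ ε > 0, ∃ n : ℕ,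
    dist (((skew T f)^[n] (x, s)).1 : AddCircle (1:ℝ)) (y : AddCircle (1:ℝ)) < ε ∧
    ((skew T f)^[n] (x, s)).2 = u


/-- The two-valued step function: `a₁` on `[0,ζ)` and `a₂` on `[ζ,1)` (values in `ℤ/Nℤ`). -/
def twoval (N : ℕ) (ζ : ℝ) (a₁ a₂ : ℤ) (x : ℝ) : ZMod N :=
  if x < ζ then (a₁ : ZMod N) else (a₂ : ZMod N)

open Topology

/-- The sum `⌊w⌋ + ⌊w + α⌋ + ⋯ + ⌊w + (m - 1) α⌋`. -/
def floorSum (α : ℝ) (m : ℕ) (w : ℝ) : ℤ := ∑ j ∈ Finset.range m, ⌊w + j * α⌋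

theorem floorSum_add_int (α : ℝ) (m : ℕ) (w : ℝ) (q : ℤ) :
    floorSum α m (w + q) = floorSum α m w + m * q := by
  have h : ∀ j : ℕ, ⌊w + q + j * α⌋ = ⌊w + j * α⌋ + q := fun j => by
    rw [add_right_comm, Int.floor_add_intCast]
  simp [floorSum, h, Finset.sum_add_distrib]

theorem floorSum_add_self (α : ℝ) (m : ℕ) (w : ℝ) :
    floorSum α m (w + α) = floorSum α m w + ⌊w + m * α⌋ - ⌊w⌋ := by
  have h := Finset.sum_range_sub (fun j : ℕ => ⌊w + j * α⌋) m
  have h' : ∀ j : ℕ, ⌊w + α + j * α⌋ = ⌊w + (j + 1 : ℕ) * α⌋ := fun j => by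
    congr 1; push_cast; ring
  rw [Finset.sum_sub_distrib] at h
  simp only [floorSum, h']
  simp only [Nat.cast_zero, zero_mul, add_zero] at h
  linarith

theorem exists_floorSum_eq_right (α : ℝ) (m : ℕ) (y : ℝ) :
    ∃ δ > 0, ∀ z, y ≤ z → z < y + δ → floorSum α m z = floorSum α m y := by
  have h : ∀ᶠ z in 𝓝[≥] y, ∀ j ∈ Finset.range m, ⌊z + j * α⌋ = ⌊y + j * α⌋ := by
    rw [Filter.eventually_all_finset]
    intro j _
    filter_upwards [Ico_mem_nhdsGE (show y < ⌊y + j * α⌋ + 1 - j * α by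
      linarith [Int.lt_floor_add_one (y + j * α)])] with z hz
    rw [Int.floor_eq_iff]
    exact ⟨by linarith [hz.1, Int.floor_le (y + j * α)], by linarith [hz.2]⟩
  obtain ⟨u, hu, hsub⟩ := mem_nhdsGE_iff_exists_Ico_subset.1 h
  refine ⟨u - y, sub_pos.2 hu, fun z hz hz' => ?_⟩
  exact Finset.sum_congr rfl (hsub ⟨hz, by linarith⟩)

theorem twoval_fract {α ζ : ℝ} {m : ℕ} (hζ : ζ = 2 - m * α) (hζmem : ζ ∈ Ioo (0 : ℝ) 1)
    (N : ℕ) (a₁ a₂ : ℤ) (w : ℝ) :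
    twoval N ζ a₁ a₂ (Int.fract w) =
      ((a₁ + (a₂ - a₁) * (⌊w + m * α⌋ - ⌊w⌋ - 1) : ℤ) : ZMod N) := by
  have h0 := Int.fract_nonneg w
  have h1 := Int.fract_lt_one w
  have hw := Int.floor_add_fract w
  obtain ⟨hζ0, hζ1⟩ := hζmem
  unfold twoval
  split_ifs with h
  · have : ⌊w + m * α⌋ = ⌊w⌋ + 1 := by
      rw [Int.floor_eq_iff]; push_cast; constructor <;> linarith
    rw [this]; congr 1; ring
  · have : ⌊w + m * α⌋ = ⌊w⌋ + 2 := by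
      rw [Int.floor_eq_iff]; push_cast; constructor <;> linarith
    rw [this]; congr 1; ring

theorem skew_iterate {α ζ : ℝ} {m : ℕ} (hζ : ζ = 2 - m * α) (hζmem : ζ ∈ Ioo (0 : ℝ) 1)
    (N : ℕ) (a₁ a₂ : ℤ) {x : ℝ} (hx : x ∈ Ico (0 : ℝ) 1) (s : ZMod N) (n : ℕ) :
    (skew (rot α) (twoval N ζ a₁ a₂))^[n] (x, s) =
      (Int.fract (x + n * α), s + ((n * (2 * a₁ - a₂) +
        (a₂ - a₁) * (floorSum α m (x + n * α) - floorSum α m x) : ℤ) : ZMod N)) := by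
  induction n with
  | zero => simp [Int.fract_eq_self.2 hx]
  | succ n ih =>
    have hstep : x + (n + 1 : ℕ) * α = x + n * α + α := by push_cast; ring
    rw [Function.iterate_succ_apply', ih, hstep]
    refine Prod.ext ?_ ?_
    · rw [skew, rot, Int.fract_eq_fract]
      exact ⟨-⌊x + n * α⌋, by rw [Int.fract]; push_cast; ring⟩
    · rw [skew, twoval_fract hζ hζmem, floorSum_add_self]
      push_cast
      ring

theorem exists_nat_mul_add_sub_int_mem_Ioo {α : ℝ} (hirr : Irrational α) (w : ℝ) {δ : ℝ}
    (hδ : 0 < δ) : ∃ (k : ℕ) (l : ℤ), k * α + w - l ∈ Ioo 0 δ := by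
  have hd : DenseRange (fun k : ℕ => k • (α : AddCircle (1 : ℝ))) := by
    rw [← denseRange_zsmul_iff_nsmul, AddCircle.denseRange_zsmul_coe_iff]
    simpa using hirr
  obtain ⟨k, hk⟩ := hd.exists_dist_lt ((δ / 2 - w : ℝ) : AddCircle (1 : ℝ)) (half_pos hδ)
  have hk' : ‖((k * α - (δ / 2 - w) : ℝ) : UnitAddCircle)‖ < δ / 2 := by
    rw [dist_comm, dist_eq_norm] at hk
    rwa [AddCircle.coe_sub, ← nsmul_eq_mul, AddCircle.coe_nsmul]
  rw [UnitAddCircle.norm_eq, abs_lt] at hk'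
  exact ⟨k, round (k * α - (δ / 2 - w)), by linarith [hk'.1], by linarith [hk'.2]⟩

theorem dist_coe_le_abs_sub (a b : ℝ) :
    dist (a : AddCircle (1 : ℝ)) (b : AddCircle (1 : ℝ)) ≤ |a - b| := by
  rw [dist_eq_norm, ← AddCircle.coe_sub, UnitAddCircle.norm_eq]
  simpa using round_le (a - b) 0

theorem abs_sub_lt_of_dist_coe_lt {z y ε : ℝ} (hz : z ∈ Ico (0 : ℝ) 1) (hy : ε ≤ y)
    (hy' : y + ε ≤ 1) (h : dist (z : AddCircle (1 : ℝ)) (y : AddCircle (1 : ℝ)) < ε) :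
    |z - y| < ε := by
  rw [dist_eq_norm, ← AddCircle.coe_sub, UnitAddCircle.norm_eq] at h
  obtain ⟨h1, h2⟩ := abs_lt.1 h
  have hr : round (z - y) = 0 := by
    have hlt : ((round (z - y) : ℤ) : ℝ) < 1 := by linarith [hz.2]
    have hgt : (-1 : ℝ) < (round (z - y) : ℤ) := by linarith [hz.1]
    have hlt' : round (z - y) < 1 := by exact_mod_cast hlt
    have hgt' : -1 < round (z - y) := by exact_mod_cast hgt
    omega
  simpa [hr] using h

theorem exists_bezout_three {a b c : ℤ} (h : ∀ k : ℤ, k ∣ a → k ∣ b → k ∣ c → IsUnit k)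
    (t : ℤ) : ∃ r p q : ℤ, r * a + p * b + q * c = t := by
  have hu := h (Int.gcd a (Int.gcd b c)) (Int.gcd_dvd_left ..)
    ((Int.gcd_dvd_right ..).trans (Int.gcd_dvd_left ..))
    ((Int.gcd_dvd_right ..).trans (Int.gcd_dvd_right ..))
  have h1 : ((Int.gcd a (Int.gcd b c) : ℕ) : ℤ) = 1 := by
    rcases Int.isUnit_iff.1 hu with h | h <;> omega
  have e1 := Int.gcd_eq_gcd_ab a (Int.gcd b c)
  have e2 := Int.gcd_eq_gcd_ab b c
  rw [h1] at e1
  refine ⟨t * a.gcdA (b.gcd c), t * (a.gcdB (b.gcd c) * b.gcdA c),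
    t * (a.gcdB (b.gcd c) * b.gcdB c), ?_⟩
  linear_combination -t * e1 - t * a.gcdB (b.gcd c) * e2

theorem minimalExt_twoval_of_unit {α ζ : ℝ} {m : ℕ} (hirr : Irrational α)
    (hζ : ζ = 2 - m * α) (hζmem : ζ ∈ Ioo (0 : ℝ) 1) {N : ℕ} (hN : 0 < N) {a₁ a₂ : ℤ}
    (h : ∀ k : ℤ, k ∣ (N : ℤ) → k ∣ 2 * a₁ - a₂ → k ∣ m * (a₂ - a₁) → IsUnit k) :
    MinimalExt (rot α) (twoval N ζ a₁ a₂) := by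
  intro x hx s y hy u ε hε
  obtain ⟨δ, hδ, hconst⟩ := exists_floorSum_eq_right α m y
  obtain ⟨t, ht⟩ := ZMod.intCast_surjective (u - s)
  obtain ⟨r, p, q, hrpq⟩ := exists_bezout_three h
    (t - (a₂ - a₁) * (floorSum α m y - floorSum α m x))
  have hNR : (0 : ℝ) < N := by exact_mod_cast hN
  set η : ℝ := min (min δ ε) (1 - y) with hη
  have hη0 : 0 < η := lt_min (lt_min hδ hε) (by linarith [hy.2])
  have hp : ((p % N).toNat : ℤ) = p - N * (p / N) := by
    rw [Int.toNat_of_nonneg (Int.emod_nonneg _ (by omega)), Int.emod_def]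
  set p' : ℕ := (p % N).toNat
  obtain ⟨k, l, hkl0, hkl1⟩ := exists_nat_mul_add_sub_int_mem_Ioo hirr
    ((x + p' * α - q - y) / N) (div_pos hη0 hNR)
  set e : ℝ := N * (k * α + (x + p' * α - q - y) / N - l) with he
  have he0 : 0 < e := mul_pos hNR hkl0
  have he1 : e < η := by
    rw [lt_div_iff₀ hNR] at hkl1
    linarith
  have hmin1 : η ≤ δ := (min_le_left _ _).trans (min_le_left _ _)
  have hmin2 : η ≤ ε := (min_le_left _ _).trans (min_le_right _ _)
  have hmin3 : η ≤ 1 - y := min_le_right _ _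
  have hpos : x + ((p' + N * k : ℕ) : ℝ) * α = y + e + ((q + N * l : ℤ) : ℝ) := by
    rw [he]
    push_cast
    field_simp
    ring
  refine ⟨p' + N * k, ?_⟩
  rw [skew_iterate hζ hζmem N a₁ a₂ hx s, hpos]
  refine ⟨?_, ?_⟩
  · rw [Int.fract_add_intCast, Int.fract_eq_self.2 ⟨by linarith [hy.1], by linarith⟩]
    refine (dist_coe_le_abs_sub _ _).trans_lt ?_
    rw [add_sub_cancel_left, abs_of_pos he0]
    linarith
  · rw [floorSum_add_int, hconst (y + e) (by linarith) (by linarith)]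
    have key : ((p' + N * k : ℕ) : ℤ) * (2 * a₁ - a₂) +
        (a₂ - a₁) * (floorSum α m y + m * (q + N * l) - floorSum α m x) =
        t + N * ((k - p / N) * (2 * a₁ - a₂) + (a₂ - a₁) * m * l - r) := by
      push_cast
      rw [hp]
      linear_combination hrpq
    rw [key]
    simp [ht]

theorem isUnit_of_minimalExt_twoval {α ζ : ℝ} {m : ℕ}
    (hζ : ζ = 2 - m * α) (hζmem : ζ ∈ Ioo (0 : ℝ) 1) {N : ℕ} {a₁ a₂ : ℤ}
    (h : MinimalExt (rot α) (twoval N ζ a₁ a₂)) {k : ℤ} (hkN : k ∣ (N : ℤ))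
    (hk₁ : k ∣ 2 * a₁ - a₂) (hk₂ : k ∣ m * (a₂ - a₁)) : IsUnit k := by
  obtain ⟨δ, hδ, hconst⟩ := exists_floorSum_eq_right α m 0
  set η : ℝ := min δ 1 with hη
  have hη0 : 0 < η := lt_min hδ one_pos
  have hηδ : η ≤ δ := min_le_left _ _
  have hη1 : η ≤ 1 := min_le_right _ _
  have hmod : ∀ v : ℤ, k ∣ v := by
    intro v
    obtain ⟨n, hd, hn⟩ := h 0 ⟨le_rfl, one_pos⟩ 0 (η / 2) ⟨by linarith, by linarith⟩ (v : ZMod N)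
      (η / 2) (half_pos hη0)
    rw [skew_iterate hζ hζmem N a₁ a₂ ⟨le_rfl, one_pos⟩] at hd hn
    have habs := abs_lt.1 (abs_sub_lt_of_dist_coe_lt
      ⟨Int.fract_nonneg _, Int.fract_lt_one _⟩ le_rfl (by linarith) hd)
    have hF := hconst _ (Int.fract_nonneg (0 + n * α)) (by linarith [habs.2])
    have hF' := floorSum_add_int α m (Int.fract (0 + n * α)) ⌊0 + n * α⌋
    rw [Int.fract_add_floor, hF] at hF'
    dsimp only at hn
    rw [zero_add (Int.cast _), ZMod.intCast_eq_intCast_iff_dvd_sub, hF'] at hn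
    have hdvd : k ∣ n * (2 * a₁ - a₂) + m * (a₂ - a₁) * ⌊0 + n * α⌋ :=
      dvd_add (hk₁.mul_left _) (hk₂.mul_right _)
    exact (dvd_add (hkN.trans hn) hdvd).trans (dvd_of_eq (by ring))
  exact isUnit_of_dvd_one (hmod 1)

/-- If `ζ₁ = 2 - mα` with `m ≥ 2`, `0 < 2 - mα < 1` and `α < 1/(m-1)`, the extension `T_f` of the rotation by `α` is minimal iff `gcd(N, a₂ + (m-2)·a₁, m·a₁) = 1`. -/
theorem twoval_minimal_iff_of_eq_two_sub_mul_alpha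
    (α : ℝ) (hα : α ∈ Ioo (0:ℝ) 1) (hirr : Irrational α) (N : ℕ) (hN : 2 ≤ N)
    (m : ℤ) (hm : 2 ≤ m) (a₁ a₂ : ℤ) (ζ : ℝ) (hζ : ζ = 2 - (m : ℝ) * α)
    (hζmem : ζ ∈ Ioo (0:ℝ) 1) (hαm : α < 1 / ((m : ℝ) - 1)) :
    MinimalExt (rot α) (twoval N ζ a₁ a₂) ↔
      ∀ k : ℤ, k ∣ (N : ℤ) → k ∣ a₂ + (m - 2) * a₁ → k ∣ m * a₁ → IsUnit k := by
  lift m to ℕ using by omega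
  rw [Int.cast_natCast] at hζ
  constructor
  · intro h k hkN hk₁ hk₂
    refine isUnit_of_minimalExt_twoval hζ hζmem h hkN ?_ ?_
    · exact (dvd_sub hk₂ hk₁).trans (dvd_of_eq (by ring))
    · exact (dvd_sub (hk₁.mul_left m) (hk₂.mul_left (m - 1))).trans (dvd_of_eq (by ring))
  · intro h
    refine minimalExt_twoval_of_unit hirr hζ hζmem (by omega) fun k hkN hk₁ hk₂ => h k hkN ?_ ?_
    · exact (dvd_add hk₂ (hk₁.mul_left (m - 1))).trans (dvd_of_eq (by ring))
    · exact (dvd_add hk₂ (hk₁.mul_left m)).trans (dvd_of_eq (by ring))
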